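/- Clifford's theorem for graphs: Let G be a graph with canonical divisor K, and let D be an effective divisor on G that is special, i.e., |K − D| ≠ ∅. Then r(D) ≤ deg(D)/2. -/

import Mathlib

open Finset

variable {V : Type}

/-- Degree of a vertex in the multigraph with edge multiplicities `m`. -/
def mdeg [Fintype V] (m : V → V → ℕ) (v : V) : ℕ := ∑ w, m v w

/-- The Laplacian of an integer-valued function on the vertices. -/
def laplacian [Fintype V] (m : V → V → ℕ) (f : V → ℤ) : V → ℤ :=
  fun v => (mdeg m v : ℤ) * f v - ∑ w, (m v w : ℤ) * f w

/-- Linear equivalence of divisors. -/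
def LinEquiv [Fintype V] (m : V → V → ℕ) (D D' : V → ℤ) : Prop :=
  ∃ f : V → ℤ, D - D' = laplacian m f

/-- A divisor is effective if it is nonnegative everywhere. -/
def Effective (D : V → ℤ) : Prop := ∀ v, 0 ≤ D v

/-- Degree of a divisor. -/
def divDeg [Fintype V] (D : V → ℤ) : ℤ := ∑ v, D v

/-- `D` is linearly equivalent to some effective divisor. -/
def Winnable [Fintype V] (m : V → V → ℕ) (D : V → ℤ) : Prop :=
  ∃ E, Effective E ∧ LinEquiv m D E

/-- Number of edges of the multigraph. -/
def edgeCount [Fintype V] (m : V → V → ℕ) : ℤ := (∑ v, ∑ w, (m v w : ℤ)) / 2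

/-- The genus `g = |E| - |V| + 1`. -/
def genus [Fintype V] (m : V → V → ℕ) : ℤ := edgeCount m - Fintype.card V + 1

/-- `m` describes a graph: symmetric, loopless, and connected. -/
def IsGraph [Fintype V] (m : V → V → ℕ) : Prop :=
  (∀ v w, m v w = m w v) ∧ (∀ v, m v v = 0) ∧
  (SimpleGraph.fromRel (fun v w => 0 < m v w)).Connected

/-- The rank `r(D)` of the linear system of a divisor. -/
noncomputable def rankDiv [Fintype V] (m : V → V → ℕ) (D : V → ℤ) : ℤ :=
  sSup {s : ℤ | s = -1 ∨ (0 ≤ s ∧ ∀ E : V → ℤ, Effective E → divDeg E = s →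
    Winnable m (D - E))}

/-- The canonical divisor `K`. -/
def canonical [Fintype V] (m : V → V → ℕ) : V → ℤ := fun v => (mdeg m v : ℤ) - 2

lemma lap_eq [Fintype V] (m : V → V → ℕ) (f : V → ℤ) (v : V) :
    laplacian m f v = ∑ w, (m v w : ℤ) * (f v - f w) := by
  simp only [laplacian, mdeg, mul_sub, Finset.sum_sub_distrib, Nat.cast_sum, Finset.sum_mul]

lemma lap_add [Fintype V] (m : V → V → ℕ) (f g : V → ℤ) :
    laplacian m (f + g) = laplacian m f + laplacian m g := by
  funext v
  simp only [lap_eq, Pi.add_apply, ← Finset.sum_add_distrib]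
  exact Finset.sum_congr rfl fun w _ => by ring

lemma lap_neg [Fintype V] (m : V → V → ℕ) (f : V → ℤ) :
    laplacian m (-f) = - laplacian m f := by
  funext v
  simp only [lap_eq, Pi.neg_apply, ← Finset.sum_neg_distrib]
  exact Finset.sum_congr rfl fun w _ => by ring

lemma lap_deg [Fintype V] (m : V → V → ℕ) (hs : ∀ v w, m v w = m w v) (f : V → ℤ) :
    divDeg (laplacian m f) = 0 := by
  have h : divDeg (laplacian m f) = - divDeg (laplacian m f) := by
    conv_lhs => simp only [divDeg, lap_eq]
    rw [Finset.sum_comm]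
    simp only [divDeg, lap_eq, ← Finset.sum_neg_distrib]
    refine Finset.sum_congr rfl fun w _ => Finset.sum_congr rfl fun v _ => ?_
    rw [hs]; ring
  omega

lemma deg_add [Fintype V] (D E : V → ℤ) : divDeg (D + E) = divDeg D + divDeg E := by
  simp [divDeg, Finset.sum_add_distrib]

lemma deg_sub [Fintype V] (D E : V → ℤ) : divDeg (D - E) = divDeg D - divDeg E := by
  simp [divDeg, Finset.sum_sub_distrib]

lemma deg_nonneg [Fintype V] {D : V → ℤ} (h : Effective D) : 0 ≤ divDeg D :=
  Finset.sum_nonneg fun v _ => h v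

lemma win_add [Fintype V] {m : V → V → ℕ} {D E : V → ℤ} (h : Winnable m D) (h' : Winnable m E) :
    Winnable m (D + E) := by
  obtain ⟨A, hA, f, hf⟩ := h
  obtain ⟨B, hB, g, hg⟩ := h'
  refine ⟨A + B, fun v => add_nonneg (hA v) (hB v), f + g, ?_⟩
  rw [lap_add, ← hf, ← hg]; abel

lemma win_eff [Fintype V] {m : V → V → ℕ} {D : V → ℤ} (h : Effective D) : Winnable m D :=
  ⟨D, h, 0, by funext v; simp [lap_eq]⟩

lemma win_deg [Fintype V] {m : V → V → ℕ} (hs : ∀ v w, m v w = m w v) {D : V → ℤ}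
    (h : Winnable m D) : 0 ≤ divDeg D := by
  obtain ⟨A, hA, f, hf⟩ := h
  have h1 := lap_deg m hs f
  rw [← hf, deg_sub] at h1
  have := deg_nonneg hA
  omega

/-- Translating by a principal divisor preserves winnability. -/
lemma win_lap [Fintype V] {m : V → V → ℕ} (f : V → ℤ) : Winnable m (laplacian m f) :=
  ⟨0, fun _ => le_rfl, f, by simp⟩

/-- The divisor of an ordering. -/
def nuDiv [Fintype V] (m : V → V → ℕ) (ρ : V → ℤ) : V → ℤ :=
  fun v => (∑ w, if ρ w < ρ v then (m v w : ℤ) else 0) - 1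

lemma nu_not_win [Fintype V] [Nonempty V] (m : V → V → ℕ) (ρ : V → ℤ) :
    ¬ Winnable m (nuDiv m ρ) := by
  classical
  rintro ⟨E, hE, f, hf⟩
  obtain ⟨v0, hv0⟩ := Finite.exists_max f
  obtain ⟨v, hv, hmin⟩ := Finset.exists_min_image (Finset.univ.filter fun v => f v = f v0) ρ
    ⟨v0, by simp⟩
  simp only [Finset.mem_filter, Finset.mem_univ, true_and] at hv hmin
  have h1 := congrFun hf v
  have h2 : (∑ w, if ρ w < ρ v then (m v w : ℤ) else 0) ≤ laplacian m f v := by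
    rw [lap_eq]
    refine Finset.sum_le_sum fun w _ => ?_
    have hw := hv0 w
    have hm : (0 : ℤ) ≤ m v w := by positivity
    split_ifs with h
    · have : f w ≠ f v0 := fun h' => absurd (hmin w h') (not_le.mpr h)
      have : 1 ≤ f v - f w := by omega
      nlinarith
    · exact mul_nonneg hm (by omega)
  have h3 := hE v
  simp only [Pi.sub_apply, nuDiv] at h1
  omega

lemma nu_add [Fintype V] (m : V → V → ℕ) (hl : ∀ v, m v v = 0) (ρ : V → ℤ)
    (hρ : Function.Injective ρ) : nuDiv m ρ + nuDiv m (-ρ) = canonical m := by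
  funext v
  have : (mdeg m v : ℤ) = (∑ w, if ρ w < ρ v then (m v w : ℤ) else 0) +
      ∑ w, if (-ρ) w < (-ρ) v then (m v w : ℤ) else 0 := by
    simp only [mdeg, Nat.cast_sum, ← Finset.sum_add_distrib]
    refine Finset.sum_congr rfl fun w _ => ?_
    rcases lt_trichotomy (ρ w) (ρ v) with h | h | h
    · simp [h, h.le]
    · rw [hρ h]; simp [hl]
    · simp [h, h.le]
  simp only [Pi.add_apply, nuDiv, canonical, this]
  ring

lemma nu_deg [Fintype V] (m : V → V → ℕ) (hs : ∀ v w, m v w = m w v) (ρ : V → ℤ) :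
    divDeg (nuDiv m (-ρ)) = divDeg (nuDiv m ρ) := by
  simp only [divDeg, nuDiv, Finset.sum_sub_distrib]
  rw [Finset.sum_comm]
  congr 1
  refine Finset.sum_congr rfl fun w _ => Finset.sum_congr rfl fun v _ => ?_
  rw [hs]; simp

lemma lap_ker [Fintype V] {m : V → V → ℕ} (hm : IsGraph m) (h : V → ℤ)
    (h0 : laplacian m h = 0) (a b : V) : h a = h b := by
  have hne : Nonempty V := ⟨a⟩
  obtain ⟨v0, hv0⟩ := Finite.exists_max h
  have key : ∀ u v, h u = h v0 → 0 < m u v → h v = h v0 := by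
    intro u v hu huv
    have h1 := congrFun h0 u
    rw [lap_eq, Pi.zero_apply, Finset.sum_eq_zero_iff_of_nonneg] at h1
    · have := h1 v (Finset.mem_univ v)
      rcases mul_eq_zero.mp this with h2 | h2
      · have : m u v = 0 := by exact_mod_cast h2
        omega
      · omega
    · intro w _
      have := hv0 w
      exact mul_nonneg (by positivity) (by omega)
  have all : ∀ v, h v = h v0 := by
    intro v
    obtain ⟨p⟩ := hm.2.2.preconnected v v0
    induction p with
    | nil => rfl
    | cons hadj p ih =>
      rename_i x y z
      have hy := ih hv0 key
      rw [SimpleGraph.fromRel_adj] at hadj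
      refine key y x hy ?_
      rcases hadj.2 with h | h
      · rw [hm.1]; exact h
      · exact h
  rw [all a, all b]

lemma exists_good [Fintype V] [DecidableEq V] {m : V → V → ℕ} (hm : IsGraph m) (D : V → ℤ)
    (hD : ¬ Winnable m D) : ∃ f : V → ℤ, ∀ S : Finset V, S.Nonempty →
      ∃ v ∈ S, (D - laplacian m f) v < ∑ w, if w ∈ S then 0 else (m v w : ℤ) := by
  let T : Set (V → ℤ) := {f | (∀ v, 0 ≤ f v) ∧ ∀ v, f v ≠ 0 → 0 ≤ (D - laplacian m f) v}
  have hzero : ∀ f ∈ T, ∃ v, f v = 0 := by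
    intro f hf
    by_contra! hc
    exact hD ⟨D - laplacian m f, fun v => hf.2 v (hc v), f, by abel⟩
  let lo : V → ℤ := fun v => min (D v) 0
  have hlo : ∀ f ∈ T, ∀ v, lo v ≤ (D - laplacian m f) v := by
    intro f hf v
    by_cases h : f v = 0
    · have : laplacian m f v ≤ 0 := by
        rw [lap_eq]
        refine Finset.sum_nonpos fun w _ => ?_
        have := hf.1 w
        exact mul_nonpos_of_nonneg_of_nonpos (by positivity) (by omega)
      simp only [lo, Pi.sub_apply]
      omega
    · have := hf.2 v h
      simp only [lo]
      omega
  have hfin : T.Finite := by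
    refine Set.Finite.of_injOn (f := fun f => D - laplacian m f)
      (t := Set.Icc lo (fun _ => divDeg D - divDeg lo)) ?_ ?_ (Set.finite_Icc _ _)
    · intro f hf
      refine ⟨fun v => hlo f hf v, fun v => ?_⟩
      have h1 : divDeg (D - laplacian m f) = divDeg D := by
        rw [deg_sub, lap_deg m hm.1]; ring
      have h2 : (D - laplacian m f - lo) v ≤ divDeg (D - laplacian m f - lo) := by
        refine Finset.single_le_sum (f := (D - laplacian m f - lo)) (fun w _ => ?_)
          (Finset.mem_univ v)
        have := hlo f hf w
        simp only [Pi.sub_apply] at this ⊢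
        omega
      rw [deg_sub, h1] at h2
      have : lo v ≤ 0 := min_le_right _ _
      simp only [Pi.sub_apply] at h2 ⊢
      omega
    · intro f hf g hg hfg
      have h1 : laplacian m f = laplacian m g := sub_right_injective hfg
      have h2 : laplacian m (f + -g) = 0 := by rw [lap_add, lap_neg, h1]; simp
      have h3 := lap_ker hm _ h2
      obtain ⟨a, ha⟩ := hzero f hf
      obtain ⟨b, hb⟩ := hzero g hg
      have h4 := h3 a b
      have := hf.1 b
      have := hg.1 a
      funext v
      have h5 := h3 v a
      simp only [Pi.add_apply, Pi.neg_apply] at h4 h5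
      omega
  obtain ⟨f, hf, hmax⟩ := Set.exists_max_image T divDeg hfin
    ⟨0, fun _ => le_rfl, fun v h => absurd rfl h⟩
  refine ⟨f, fun S hS => ?_⟩
  by_contra! hc
  let e : V → ℤ := fun v => if v ∈ S then 1 else 0
  have hin : ∀ v ∈ S, laplacian m e v = ∑ w, if w ∈ S then 0 else (m v w : ℤ) := by
    intro v hv
    rw [lap_eq]
    refine Finset.sum_congr rfl fun w _ => ?_
    by_cases hw : w ∈ S <;> simp [e, hv, hw]
  have hout : ∀ v ∉ S, laplacian m e v ≤ 0 := by
    intro v hv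
    rw [lap_eq]
    refine Finset.sum_nonpos fun w _ => ?_
    by_cases hw : w ∈ S <;> simp [e, hv, hw]
  have hT : f + e ∈ T := by
    constructor
    · intro v
      have := hf.1 v
      simp only [Pi.add_apply, e]
      split_ifs <;> omega
    · intro v hv
      rw [lap_add]
      by_cases h : v ∈ S
      · have h1 := hc v h
        rw [← hin v h] at h1
        simp only [Pi.sub_apply, Pi.add_apply] at h1 ⊢
        omega
      · have h1 := hout v h
        have h2 := hf.2 v (by simpa [e, h] using hv)
        simp only [Pi.sub_apply, Pi.add_apply] at h2 ⊢
        omega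
  have h1 := hmax _ hT
  rw [deg_add] at h1
  have h2 : divDeg e = S.card := by simp [divDeg, e]
  have := hS.card_pos
  omega

lemma exists_order [Fintype V] [DecidableEq V] (m : V → V → ℕ) (D : V → ℤ)
    (h : ∀ S : Finset V, S.Nonempty →
      ∃ v ∈ S, D v < ∑ w, if w ∈ S then 0 else (m v w : ℤ)) (n : ℕ) :
    ∀ S : Finset V, S.card = n → ∃ ρ : V → ℤ, (∀ v, 0 ≤ ρ v) ∧ Set.InjOn ρ S ∧
      ∀ v ∈ S, D v < ∑ w, if w ∉ S ∨ ρ w < ρ v then (m v w : ℤ) else 0 := by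
  induction n with
  | zero =>
    intro S hS
    rw [Finset.card_eq_zero] at hS
    subst hS
    exact ⟨0, fun _ => le_rfl, by simp, by simp⟩
  | succ n ih =>
    intro S hS
    obtain ⟨v, hv, hlt⟩ := h S (Finset.card_pos.mp (by omega))
    obtain ⟨ρ, h0, hinj, hρ⟩ := ih (S.erase v) (by rw [Finset.card_erase_of_mem hv]; omega)
    refine ⟨fun w => if w = v then 0 else ρ w + 1, ?_, ?_, ?_⟩
    · intro w
      have := h0 w
      dsimp only
      split_ifs <;> omega
    · intro a ha b hb hab
      have h1 := h0 a
      have h2 := h0 b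
      dsimp only at hab
      split_ifs at hab with h3 h4 h4
      · rw [h3, h4]
      · omega
      · omega
      · refine hinj ?_ ?_ (by omega)
        · simpa [h3] using ha
        · simpa [h4] using hb
    · intro a ha
      by_cases hav : a = v
      · subst hav
        refine hlt.trans_le (Finset.sum_le_sum fun w _ => ?_)
        by_cases hw : w ∈ S
        · simp only [hw, if_true]; split_ifs <;> positivity
        · simp [hw]
      · refine (hρ a (by simp [hav, ha])).trans_le (Finset.sum_le_sum fun w _ => ?_)
        have h1 := h0 a
        by_cases hw : w ∉ S.erase v ∨ ρ w < ρ a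
        · rw [if_pos hw, if_pos]
          by_cases hwv : w = v
          · right; simp only [hwv, hav, if_true, if_false]; omega
          · rcases hw with hw | hw
            · left; simpa [hwv] using hw
            · right; simp only [hwv, hav, if_false]; omega
        · rw [if_neg hw]; split_ifs <;> positivity

lemma exists_nu [Fintype V] {m : V → V → ℕ} (hm : IsGraph m) (D : V → ℤ)
    (hD : ¬ Winnable m D) :
    ∃ ρ : V → ℤ, Function.Injective ρ ∧ Winnable m (nuDiv m ρ - D) := by
  classical
  obtain ⟨f, hf⟩ := exists_good hm D hD
  obtain ⟨ρ, -, hinj, hρ⟩ := exists_order m _ hf _ Finset.univ rfl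
  refine ⟨ρ, by simpa using hinj, nuDiv m ρ - (D - laplacian m f), ?_, -f, ?_⟩
  · intro v
    have := hρ v (Finset.mem_univ v)
    simp only [Finset.mem_univ, not_true_eq_false, false_or] at this
    simp only [Pi.sub_apply, nuDiv] at this ⊢
    omega
  · rw [lap_neg]; abel

lemma exists_split [Fintype V] (E : V → ℤ) (hE : Effective E) (s : ℕ)
    (hs : (s : ℤ) ≤ divDeg E) :
    ∃ A : V → ℤ, Effective A ∧ Effective (E - A) ∧ divDeg A = s := by
  classical
  induction s with
  | zero => exact ⟨0, fun _ => le_rfl, by simpa using hE, by simp [divDeg]⟩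
  | succ s ih =>
    obtain ⟨A, hA, hEA, hd⟩ := ih (by push_cast at hs; omega)
    have h1 : 0 < divDeg (E - A) := by rw [deg_sub, hd]; push_cast at hs; omega
    obtain ⟨q, -, hq⟩ : ∃ q ∈ Finset.univ, 0 < (E - A) q := by
      by_contra! hc
      exact absurd (Finset.sum_nonpos hc) (not_le.mpr h1)
    refine ⟨A + Pi.single q 1, ?_, ?_, ?_⟩
    · intro v
      have := hA v
      by_cases h : v = q
      · subst h; simp; omega
      · simpa [h] using this
    · intro v
      have := hEA v
      by_cases h : v = q
      · subst h; simp at hq ⊢; omega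
      · simpa [h] using this
    · rw [deg_add, hd]; simp [divDeg]

theorem clifford_for_graphs [Fintype V] (m : V → V → ℕ) (hm : IsGraph m)
    (D : V → ℤ) (hD : Effective D) (hspecial : Winnable m (canonical m - D)) :
    2 * rankDiv m D ≤ divDeg D := by
  classical
  have hne : Nonempty V := hm.2.2.nonempty
  have hD0 := deg_nonneg hD
  suffices h : rankDiv m D ≤ divDeg D / 2 by omega
  refine csSup_le ⟨-1, Or.inl rfl⟩ ?_
  rintro s (rfl | ⟨hs0, hs⟩)
  · omega
  obtain ⟨q⟩ := id hne
  -- an effective divisor of degree g which K minus it is not winnable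
  have hq : ¬ Winnable m (-Pi.single q 1 : V → ℤ) := by
    intro h
    have := win_deg hm.1 h
    simp [divDeg] at this
  obtain ⟨ρ, hinj, G, hG, hGe⟩ := exists_nu hm _ hq
  have hK := nu_add m hm.2.1 ρ hinj
  have hdegK : divDeg (canonical m) = 2 * divDeg (nuDiv m ρ) := by
    rw [← hK, deg_add, nu_deg m hm.1]; ring
  set n := divDeg (nuDiv m ρ) with hn
  have hGd : divDeg G = n + 1 := by
    obtain ⟨f, hf⟩ := hGe
    have := lap_deg m hm.1 f
    rw [← hf, deg_sub, deg_sub] at this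
    simp [divDeg] at this
    simp only [divDeg] at hn ⊢
    omega
  have hKG : ¬ Winnable m (canonical m - G) := by
    intro h
    obtain ⟨f, hf⟩ := hGe
    refine nu_not_win m (-ρ) ?_
    have h1 := win_add h (win_add (win_lap (m := m) (-f))
      (win_eff (m := m) (D := Pi.single q 1) (by
        intro v; by_cases h : v = q
        · subst h; simp
        · simp [h])))
    convert h1 using 1
    rw [lap_neg, ← hf, ← hK]; abel
  -- the rank of K is at most g - 1
  have main : ∀ t : ℤ, 0 ≤ t → (∀ F : V → ℤ, Effective F → divDeg F = t →
      Winnable m (canonical m - D - F)) → s + t ≤ n := by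
    intro t ht hF
    by_contra! hlt
    let E : V → ℤ := G + Pi.single q (s + t - (n + 1))
    have hX : Effective (Pi.single q (s + t - (n + 1)) : V → ℤ) := by
      intro v; by_cases h : v = q
      · subst h; simp; omega
      · simp [h]
    have hE : Effective E := fun v => add_nonneg (hG v) (hX v)
    have hEd : divDeg E = s + t := by
      simp only [E]
      rw [deg_add, hGd]; simp [divDeg]
    obtain ⟨A, hA, hEA, hAd⟩ := exists_split E hE s.toNat (by omega)
    rw [Int.toNat_of_nonneg hs0] at hAd
    have h1 := win_add (win_add (hs A hA hAd)
      (hF (E - A) hEA (by rw [deg_sub]; omega))) (win_eff (m := m) hX)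
    apply hKG
    convert h1 using 1
    simp only [E]; abel
  have h0 : s ≤ n := by
    have := main 0 le_rfl (by
      intro F hF hF0
      have : F = 0 := by
        funext v
        exact (Finset.sum_eq_zero_iff_of_nonneg fun w _ => hF w).mp hF0 v (Finset.mem_univ v)
      rw [this]; simpa using hspecial)
    omega
  by_cases ht : 0 ≤ s - divDeg D + n
  · have := main _ ht (by
      intro F hF hFd
      by_contra hw
      obtain ⟨τ, hτ, E, hE, f, hf⟩ := exists_nu hm _ hw
      have hK' := nu_add m hm.2.1 τ hτ
      have hd : divDeg (canonical m) = 2 * divDeg (nuDiv m τ) := by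
        rw [← hK', deg_add, nu_deg m hm.1]; ring
      have hEd : divDeg E = s := by
        have := lap_deg m hm.1 f
        rw [← hf] at this
        simp only [deg_sub] at this
        omega
      refine nu_not_win m (-τ) ?_
      have h1 := win_add (win_add (hs E hE hEd) (win_lap (m := m) (-f))) (win_eff (m := m) hF)
      convert h1 using 1
      rw [lap_neg, ← hf, ← hK']; abel)
    omega
  · omega
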